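/- Fix λ ∈ [0,1]. Suppose (x*, y*) ∈ F minimizes the λ-weighted objective λz₁ + (1−λ)z₂ over F. Then the lifted point (θ₁*, θ₂*, y*) := (c¹·x*, c²·x*, y*) belongs to R and minimizes the λ-weighted reformulation objective λw₁ + (1−λ)w₂ over R, and the two optimal values coincide: λw₁(θ₁*,θ₂*,y*) + (1−λ)w₂(θ₁*,θ₂*,y*) = λz₁(x*,y*) + (1−λ)z₂(x*,y*). -/

import Mathlib

open Matrix

/-- Feasible set of the bi-objective linear program (BLP):
`Ax + By ≥ b`, `Dy ≥ d`, `x ≥ 0`, `y ≥ 0`. -/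
def BFeas {p n q s : ℕ} (A : Matrix (Fin p) (Fin n) ℝ) (B : Matrix (Fin p) (Fin q) ℝ)
    (D : Matrix (Fin s) (Fin q) ℝ) (b : Fin p → ℝ) (d : Fin s → ℝ)
    (x : Fin n → ℝ) (y : Fin q → ℝ) : Prop :=
  b ≤ A.mulVec x + B.mulVec y ∧ d ≤ D.mulVec y ∧ 0 ≤ x ∧ 0 ≤ y

/-- Feasible set of the Benders reformulation: `Dy ≥ d`, `y ≥ 0`, all feasibility (ray)
cuts and all weighted optimality cuts for `λ ∈ [0,1]`. -/
def BRefeas {p n q s : ℕ} (A : Matrix (Fin p) (Fin n) ℝ) (B : Matrix (Fin p) (Fin q) ℝ)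
    (D : Matrix (Fin s) (Fin q) ℝ) (b : Fin p → ℝ) (d : Fin s → ℝ)
    (c1 c2 : Fin n → ℝ) (θ1 θ2 : ℝ) (y : Fin q → ℝ) : Prop :=
  d ≤ D.mulVec y ∧ 0 ≤ y ∧
  (∀ π : Fin p → ℝ, 0 ≤ π → Aᵀ.mulVec π ≤ 0 → π ⬝ᵥ (b - B.mulVec y) ≤ 0) ∧
  (∀ lam : ℝ, lam ∈ Set.Icc (0 : ℝ) 1 → ∀ π : Fin p → ℝ, 0 ≤ π →
    Aᵀ.mulVec π ≤ lam • c1 + (1 - lam) • c2 →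
    π ⬝ᵥ (b - B.mulVec y) ≤ lam * θ1 + (1 - lam) * θ2)

/-- Algebraic Farkas lemma (inductive proof due to Bartl). -/
lemma farkas_aux {V ι : Type*} [AddCommGroup V] [Module ℝ V] [DecidableEq ι] (S : Finset ι) :
    ∀ (a : ι → V →ₗ[ℝ] ℝ) (g : V →ₗ[ℝ] ℝ),
      (∀ v, (∀ i ∈ S, a i v ≤ 0) → g v ≤ 0) →
      ∃ l : ι → ℝ, (∀ i, 0 ≤ l i) ∧ ∀ v, g v = ∑ i ∈ S, l i * a i v := by
  induction S using Finset.induction_on with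
  | empty =>
    intro a g h
    refine ⟨0, fun i => le_rfl, fun v => ?_⟩
    have h1 := h v (by simp)
    have h2 := h (-v) (by simp)
    rw [map_neg] at h2
    simp only [Finset.sum_empty]
    linarith
  | insert m S hm ih =>
    intro a g h
    by_cases hc : ∀ v, (∀ i ∈ S, a i v ≤ 0) → g v ≤ 0
    · obtain ⟨l, hl, hg⟩ := ih a g hc
      refine ⟨fun i => if i = m then 0 else l i, fun i => ?_, fun v => ?_⟩
      · dsimp only
        split_ifs
        exacts [le_rfl, hl i]
      · rw [Finset.sum_insert hm, hg v]
        simp only [if_true, zero_mul, zero_add]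
        refine Finset.sum_congr rfl fun i hi => ?_
        rw [if_neg (ne_of_mem_of_not_mem hi hm)]
    · push Not at hc
      obtain ⟨u, hu, hgu⟩ := hc
      have hmu : 0 < a m u := by
        by_contra hcon
        push Not at hcon
        have := h u (by
          intro i hi
          rcases Finset.mem_insert.1 hi with rfl | hi
          exacts [hcon, hu i hi])
        linarith
      have key := ih (fun i => a i - (a i u / a m u) • a m) (g - (g u / a m u) • a m) (by
        intro v hv
        have := h (v - (a m v / a m u) • u) (by
          intro i hi
          rcases Finset.mem_insert.1 hi with rfl | hi
          · simp only [map_sub, map_smul, smul_eq_mul]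
            rw [div_mul_cancel₀ _ (ne_of_gt hmu)]
            simp
          · have := hv i hi
            simp only [LinearMap.sub_apply, LinearMap.smul_apply, smul_eq_mul] at this
            simp only [map_sub, map_smul, smul_eq_mul]
            have e : a m v / a m u * a i u = a i u / a m u * a m v := by ring
            linarith)
        simp only [map_sub, map_smul, smul_eq_mul] at this
        simp only [LinearMap.sub_apply, LinearMap.smul_apply, smul_eq_mul]
        have e : a m v / a m u * g u = g u / a m u * a m v := by ring
        linarith)
      obtain ⟨l, hl, hg⟩ := key
      refine ⟨fun i => if i = m then (g u - ∑ i ∈ S, l i * a i u) / a m u else l i,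
        fun i => ?_, fun v => ?_⟩
      · dsimp only
        split_ifs
        · refine div_nonneg ?_ hmu.le
          have : ∑ i ∈ S, l i * a i u ≤ 0 :=
            Finset.sum_nonpos fun i hi => mul_nonpos_of_nonneg_of_nonpos (hl i) (hu i hi)
          linarith
        · exact hl i
      · rw [Finset.sum_insert hm]
        simp only [if_true]
        have e1 : ∑ i ∈ S, (if i = m then (g u - ∑ i ∈ S, l i * a i u) / a m u else l i) * a i v
            = ∑ i ∈ S, l i * a i v := by
          refine Finset.sum_congr rfl fun i hi => ?_
          rw [if_neg (ne_of_mem_of_not_mem hi hm)]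
        rw [e1]
        have e2 := hg v
        simp only [LinearMap.sub_apply, LinearMap.smul_apply, smul_eq_mul] at e2
        have e3 : ∑ i ∈ S, l i * (a i v - a i u / a m u * a m v)
            = ∑ i ∈ S, l i * a i v - (∑ i ∈ S, l i * a i u) / a m u * a m v := by
          rw [Finset.sum_div, Finset.sum_mul, ← Finset.sum_sub_distrib]
          exact Finset.sum_congr rfl fun i _ => by ring
        rw [e3] at e2
        rw [sub_div, sub_mul]
        linarith

/-- Existence of a primal point with prescribed value bound, from all the cuts. -/
lemma exists_primal {p n : ℕ} (A : Matrix (Fin p) (Fin n) ℝ) (r : Fin p → ℝ) (c : Fin n → ℝ)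
    (t : ℝ) (h0 : ∀ π : Fin p → ℝ, 0 ≤ π → Aᵀ.mulVec π ≤ 0 → π ⬝ᵥ r ≤ 0)
    (h1 : ∀ π : Fin p → ℝ, 0 ≤ π → Aᵀ.mulVec π ≤ c → π ⬝ᵥ r ≤ t) :
    ∃ x : Fin n → ℝ, 0 ≤ x ∧ r ≤ A.mulVec x ∧ c ⬝ᵥ x ≤ t := by
  classical
  let dp : (Fin p → ℝ) → ((Fin p → ℝ) × ℝ →ₗ[ℝ] ℝ) := fun w =>
    (dotProductBilin ℝ ℝ w).comp (LinearMap.fst ℝ (Fin p → ℝ) ℝ)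
  let sn : (Fin p → ℝ) × ℝ →ₗ[ℝ] ℝ := LinearMap.snd ℝ (Fin p → ℝ) ℝ
  have hdp : ∀ w v, dp w v = w ⬝ᵥ v.1 := fun w v => rfl
  have hsn : ∀ v, sn v = v.2 := fun v => rfl
  let a : Fin n ⊕ (Fin p ⊕ Unit) → ((Fin p → ℝ) × ℝ →ₗ[ℝ] ℝ) :=
    Sum.elim (fun j => dp (Aᵀ j) - c j • sn)
      (Sum.elim (fun i => - dp (Pi.single i 1)) (fun _ => - sn))
  obtain ⟨l, hl, hg⟩ := farkas_aux Finset.univ a (dp r - t • sn) (by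
    rintro ⟨π, μ⟩ hv
    have hA : ∀ j, Aᵀ.mulVec π j ≤ μ * c j := by
      intro j
      have := hv (Sum.inl j) (Finset.mem_univ _)
      simp only [a, Sum.elim_inl, LinearMap.sub_apply, LinearMap.smul_apply, smul_eq_mul, hdp,
        hsn] at this
      change Aᵀ j ⬝ᵥ π ≤ _
      linarith
    have hπ : 0 ≤ π := by
      intro i
      have := hv (Sum.inr (Sum.inl i)) (Finset.mem_univ _)
      simpa [a, hdp] using this
    have hμ : 0 ≤ μ := by
      have := hv (Sum.inr (Sum.inr ())) (Finset.mem_univ _)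
      simpa [a, hsn] using this
    simp only [LinearMap.sub_apply, LinearMap.smul_apply, smul_eq_mul, hdp, hsn]
    rw [dotProduct_comm]
    rcases hμ.eq_or_lt with rfl | hμ
    · have := h0 π hπ (fun j => by simpa using hA j)
      linarith
    · have := h1 (μ⁻¹ • π) (smul_nonneg (inv_nonneg.2 hμ.le) hπ) (fun j => by
        rw [mulVec_smul, Pi.smul_apply, smul_eq_mul, inv_mul_le_iff₀ hμ]
        exact hA j)
      rw [smul_dotProduct, smul_eq_mul, inv_mul_le_iff₀ hμ] at this
      linarith)
  refine ⟨fun j => l (Sum.inl j), fun j => hl _, fun i => ?_, ?_⟩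
  · have := hg (Pi.single i 1, 0)
    simp only [a, Fintype.sum_sum_type, Sum.elim_inl, Sum.elim_inr, LinearMap.sub_apply,
      LinearMap.smul_apply, LinearMap.neg_apply, smul_eq_mul, hdp, hsn, dotProduct_single,
      mul_one, mul_zero, sub_zero, neg_zero, Finset.sum_const_zero, add_zero,
      transpose_apply] at this
    have e : ∑ k, l (Sum.inr (Sum.inl k)) * -(Pi.single k (1 : ℝ) : Fin p → ℝ) i ≤ 0 := by
      refine Finset.sum_nonpos fun k _ => mul_nonpos_of_nonneg_of_nonpos (hl _) ?_
      rw [Pi.single_apply]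
      split_ifs <;> simp
    have e2 : A.mulVec (fun j => l (Sum.inl j)) i = ∑ j, l (Sum.inl j) * A i j := by
      simp only [mulVec, dotProduct]
      exact Finset.sum_congr rfl fun j _ => mul_comm _ _
    rw [e2]
    linarith
  · have := hg (0, 1)
    simp only [a, Fintype.sum_sum_type, Sum.elim_inl, Sum.elim_inr, LinearMap.sub_apply,
      LinearMap.smul_apply, LinearMap.neg_apply, smul_eq_mul, hdp, hsn, dotProduct_zero,
      mul_one, mul_zero, zero_sub, neg_zero, Finset.sum_const_zero, zero_add,
      Finset.univ_unique, Finset.sum_singleton, mul_neg, Finset.sum_neg_distrib] at this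
    have e := hl (Sum.inr (Sum.inr default))
    have e2 : c ⬝ᵥ (fun j => l (Sum.inl j)) = ∑ j, l (Sum.inl j) * c j := by
      simp only [dotProduct]
      exact Finset.sum_congr rfl fun j _ => mul_comm _ _
    rw [e2]
    linarith

/-- Weak duality. -/
lemma weak_dual {p n : ℕ} (A : Matrix (Fin p) (Fin n) ℝ) (r : Fin p → ℝ) (c x : Fin n → ℝ)
    (π : Fin p → ℝ) (hπ : 0 ≤ π) (hx : 0 ≤ x) (hr : r ≤ A.mulVec x) (hA : Aᵀ.mulVec π ≤ c) :
    π ⬝ᵥ r ≤ c ⬝ᵥ x := by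
  calc π ⬝ᵥ r ≤ π ⬝ᵥ A.mulVec x := dotProduct_le_dotProduct_of_nonneg_left hr hπ
    _ = Aᵀ.mulVec π ⬝ᵥ x := by rw [dotProduct_mulVec, mulVec_transpose]
    _ ≤ c ⬝ᵥ x := dotProduct_le_dotProduct_of_nonneg_right hA hx

/-- If `(x*, y*)` minimizes the `λ`-weighted objective over the BLP feasible set `F`,
then the lifted point `(c¹·x*, c²·x*, y*)` belongs to `R`, minimizes the `λ`-weighted
reformulation objective over `R`, and the two optimal values coincide. -/
theorem weighted_optimum_lifts_to_reformulation
    {p n q s : ℕ} (A : Matrix (Fin p) (Fin n) ℝ) (B : Matrix (Fin p) (Fin q) ℝ)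
    (D : Matrix (Fin s) (Fin q) ℝ) (b : Fin p → ℝ) (d : Fin s → ℝ)
    (c1 c2 : Fin n → ℝ) (f1 f2 : Fin q → ℝ)
    (lam : ℝ) (hlam : lam ∈ Set.Icc (0 : ℝ) 1)
    (xs : Fin n → ℝ) (ys : Fin q → ℝ)
    (hfeas : BFeas A B D b d xs ys)
    (hopt : ∀ x y, BFeas A B D b d x y →
      lam * (c1 ⬝ᵥ xs + f1 ⬝ᵥ ys) + (1 - lam) * (c2 ⬝ᵥ xs + f2 ⬝ᵥ ys) ≤
        lam * (c1 ⬝ᵥ x + f1 ⬝ᵥ y) + (1 - lam) * (c2 ⬝ᵥ x + f2 ⬝ᵥ y)) :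
    BRefeas A B D b d c1 c2 (c1 ⬝ᵥ xs) (c2 ⬝ᵥ xs) ys ∧
    (∀ θ1 θ2 : ℝ, ∀ y : Fin q → ℝ, BRefeas A B D b d c1 c2 θ1 θ2 y →
      lam * ((c1 ⬝ᵥ xs) + f1 ⬝ᵥ ys) + (1 - lam) * ((c2 ⬝ᵥ xs) + f2 ⬝ᵥ ys) ≤
        lam * (θ1 + f1 ⬝ᵥ y) + (1 - lam) * (θ2 + f2 ⬝ᵥ y)) ∧
    lam * ((c1 ⬝ᵥ xs) + f1 ⬝ᵥ ys) + (1 - lam) * ((c2 ⬝ᵥ xs) + f2 ⬝ᵥ ys) =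
      lam * (c1 ⬝ᵥ xs + f1 ⬝ᵥ ys) + (1 - lam) * (c2 ⬝ᵥ xs + f2 ⬝ᵥ ys) := by
  obtain ⟨h1, h2, h3, h4⟩ := hfeas
  have hr : b - B.mulVec ys ≤ A.mulVec xs := sub_le_iff_le_add.2 h1
  refine ⟨⟨h2, h4, fun π hπ hA => ?_, fun μ _ π hπ hA => ?_⟩, fun θ1 θ2 y hR => ?_, rfl⟩
  · simpa using weak_dual A _ 0 xs π hπ h3 hr hA
  · simpa [add_dotProduct, smul_dotProduct] using weak_dual A _ _ xs π hπ h3 hr hA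
  · obtain ⟨g1, g2, g3, g4⟩ := hR
    obtain ⟨x, hx, hAx, hcx⟩ := exists_primal A (b - B.mulVec y) (lam • c1 + (1 - lam) • c2)
      (lam * θ1 + (1 - lam) * θ2) g3 (g4 lam hlam)
    have := hopt x y ⟨sub_le_iff_le_add.1 hAx, g1, hx, g2⟩
    simp only [add_dotProduct, smul_dotProduct, smul_eq_mul] at hcx
    linarith
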